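/- Let n ≥ 2 and k be integers with 1 ≤ k ≤ n−1. Let g, h₁, …, h_k : ℝⁿ → ℝ be Lipschitz functions and let i₀ < i₁ < … < i_k be distinct indices in {1, …, n}. Denote by ∂_i u the almost-everywhere defined partial derivative of a Lipschitz function u in the direction of the i-th standard basis vector. Then for every smooth compactly supported function φ : ℝⁿ → ℝ one has ∫_{ℝⁿ} det A(x) · φ(x) dx = − Σ_{a=0}^{k} (−1)^a ∫_{ℝⁿ} g(x) · det B_a(x) · ∂_{i_a}φ(x) dx, where A(x) is the (k+1)×(k+1) matrix whose row indexed by a ∈ {0,…,k} is (∂_{i_a}g(x), ∂_{i_a}h₁(x), …, ∂_{i_a}h_k(x)), and B_a(x) is the k×k matrix (∂_{i_b}h_j(x)) with rows indexed by b ∈ {0,…,k} \ {a} (in increasing order) and columns j ∈ {1,…,k}. All integrals are with respect to Lebesgue measure on ℝⁿ. -/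

import Mathlib

open MeasureTheory

/-- The almost-everywhere defined partial derivative of a (Lipschitz) function
`u : ℝⁿ → ℝ` in the direction of the `i`-th standard basis vector, realized via
the Fréchet derivative (which exists a.e. by Rademacher's theorem). -/
noncomputable def pd {n : ℕ} (u : (Fin n → ℝ) → ℝ) (i : Fin n) (x : Fin n → ℝ) : ℝ :=
  fderiv ℝ u x (Pi.single i 1)

section

open Filter Set
open scoped Topology ContDiff Convolution

section Mollification

variable {E : Type*} [NormedAddCommGroup E] [NormedSpace ℝ E] [FiniteDimensional ℝ E]
  [MeasurableSpace E] [BorelSpace E] {μ : Measure E} [μ.IsAddHaarMeasure]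
  {f : E → ℝ} {K : NNReal}

theorem LipschitzWith.locallyIntegrable_fderiv (hf : LipschitzWith K f) :
    LocallyIntegrable (fderiv ℝ f) μ :=
  (locallyIntegrable_const (K : ℝ)).mono (measurable_fderiv ℝ f).aestronglyMeasurable <|
    .of_forall fun x => by simpa using norm_fderiv_le_of_lipschitz ℝ hf

namespace ContDiffBump

variable (ρ : ContDiffBump (0 : E))

theorem integrable_normed_smul_comp_sub (hf : Continuous f) (x : E) :
    Integrable (fun t => ρ.normed μ t * f (x - t)) μ :=
  (ρ.continuous_normed.mul (hf.comp (continuous_sub_left x))).integrable_of_hasCompactSupport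
    ρ.hasCompactSupport_normed.mul_right

theorem lipschitzWith_normed_convolution (hf : LipschitzWith K f) :
    LipschitzWith K (ρ.normed μ ⋆[ContinuousLinearMap.lsmul ℝ ℝ, μ] f) := by
  refine LipschitzWith.of_dist_le_mul fun x y => ?_
  simp only [convolution_def, ContinuousLinearMap.lsmul_apply, smul_eq_mul, dist_eq_norm]
  rw [← integral_sub (ρ.integrable_normed_smul_comp_sub hf.continuous x)
    (ρ.integrable_normed_smul_comp_sub hf.continuous y)]
  calc ‖∫ t, ρ.normed μ t * f (x - t) - ρ.normed μ t * f (y - t) ∂μ‖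
      ≤ ∫ t, ρ.normed μ t * (K * ‖x - y‖) ∂μ := by
        refine norm_integral_le_of_norm_le (ρ.integrable_normed.mul_const _) (.of_forall fun t => ?_)
        rw [← mul_sub, norm_mul, Real.norm_of_nonneg (ρ.nonneg_normed t)]
        refine mul_le_mul_of_nonneg_left ?_ (ρ.nonneg_normed t)
        simpa using hf.norm_sub_le (x - t) (y - t)
    _ = K * ‖x - y‖ := by rw [integral_mul_const, ρ.integral_normed, one_mul]

theorem fderiv_normed_convolution (hf : LipschitzWith K f) (x : E) :
    fderiv ℝ (ρ.normed μ ⋆[ContinuousLinearMap.lsmul ℝ ℝ, μ] f) x =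
      (ρ.normed μ ⋆[ContinuousLinearMap.lsmul ℝ ℝ, μ] fderiv ℝ f) x := by
  have hdiff : ∀ᵐ t ∂μ, DifferentiableAt ℝ f (x - t) :=
    (Measure.measurePreserving_sub_left μ x).quasiMeasurePreserving.ae hf.ae_differentiableAt
  refine (hasFDerivAt_integral_of_dominated_loc_of_lip
    (bound := fun t => ρ.normed μ t * K) univ_mem
    (.of_forall fun y => (ρ.integrable_normed_smul_comp_sub hf.continuous y).aestronglyMeasurable)
    (ρ.integrable_normed_smul_comp_sub hf.continuous x) ?_ (.of_forall fun t => ?_)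
    (ρ.integrable_normed.mul_const _) ?_).2.fderiv
  · exact (ρ.continuous_normed.stronglyMeasurable.smul ((measurable_fderiv ℝ f).comp
      (measurable_const.sub measurable_id)).stronglyMeasurable).aestronglyMeasurable
  · refine LipschitzWith.lipschitzOnWith (LipschitzWith.of_dist_le_mul fun y z => ?_)
    have hK : |ρ.normed μ t * K| = ρ.normed μ t * K :=
      abs_of_nonneg (mul_nonneg (ρ.nonneg_normed t) K.2)
    rw [Real.coe_nnabs, hK, dist_eq_norm, dist_eq_norm, ← mul_sub, norm_mul,
      Real.norm_of_nonneg (ρ.nonneg_normed t), mul_assoc]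
    refine mul_le_mul_of_nonneg_left ?_ (ρ.nonneg_normed t)
    simpa [dist_eq_norm] using hf.norm_sub_le (y - t) (z - t)
  · filter_upwards [hdiff] with t ht
    have h := ht.hasFDerivAt.comp x ((hasFDerivAt_id x).sub_const t)
    exact h.const_mul (ρ.normed μ t)

end ContDiffBump

theorem LipschitzWith.exists_contDiff_tendsto {ι : Type*} [Finite ι] {f : ι → E → ℝ}
    {K : ι → NNReal} (hf : ∀ i, LipschitzWith (K i) (f i)) :
    ∃ F : ℕ → ι → E → ℝ, (∀ m i, ContDiff ℝ ∞ (F m i)) ∧ (∀ m i, LipschitzWith (K i) (F m i)) ∧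
      (∀ i x, Tendsto (fun m => F m i x) atTop (𝓝 (f i x))) ∧
      (∀ᵐ x ∂μ, ∀ i, Tendsto (fun m => fderiv ℝ (F m i) x) atTop (𝓝 (fderiv ℝ (f i) x))) := by
  let ρ : ℕ → ContDiffBump (0 : E) := fun m =>
    ⟨1 / ((m : ℝ) + 1), 2 * (1 / ((m : ℝ) + 1)), by positivity,
      lt_mul_of_one_lt_left (by positivity) one_lt_two⟩
  have hρ : Tendsto (fun m => (ρ m).rOut) atTop (𝓝 0) := by
    simpa [ρ] using tendsto_one_div_add_atTop_nhds_zero_nat (𝕜 := ℝ) |>.const_mul 2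
  refine ⟨fun m i => (ρ m).normed μ ⋆[ContinuousLinearMap.lsmul ℝ ℝ, μ] f i, fun m i => ?_,
    fun m i => (ρ m).lipschitzWith_normed_convolution (hf i), fun i x => ?_, ?_⟩
  · exact (ρ m).hasCompactSupport_normed.contDiff_convolution_left _ (ρ m).contDiff_normed
      (hf i).continuous.locallyIntegrable
  · exact ContDiffBump.convolution_tendsto_right_of_continuous hρ (hf i).continuous x
  · refine ae_all_iff.2 fun i => ?_
    filter_upwards [ContDiffBump.ae_convolution_tendsto_right_of_locallyIntegrable (K := 2) hρ
      (.of_forall fun m => le_rfl) (hf i).locallyIntegrable_fderiv] with x hx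
    simpa only [ContDiffBump.fderiv_normed_convolution _ (hf i)] using hx

end Mollification

section Smooth

variable {n k : ℕ}

theorem ContDiff.pd {u : (Fin n → ℝ) → ℝ} (hu : ContDiff ℝ ∞ u) (i : Fin n) :
    ContDiff ℝ ∞ (pd u i) :=
  (hu.fderiv_right (m := ∞) (by simp)).clm_apply contDiff_const

theorem HasCompactSupport.pd {u : (Fin n → ℝ) → ℝ} (hu : HasCompactSupport u) (i : Fin n) :
    HasCompactSupport (pd u i) :=
  hu.fderiv_apply ℝ _

theorem pd_comm {u : (Fin n → ℝ) → ℝ} (hu : ContDiff ℝ ∞ u) (i j : Fin n) (x : Fin n → ℝ) :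
    pd (pd u i) j x = pd (pd u j) i x := by
  have key : ∀ i j, pd (pd u i) j x = fderiv ℝ (fderiv ℝ u) x (Pi.single j 1) (Pi.single i 1) := by
    intro i j
    have hd : DifferentiableAt ℝ (fderiv ℝ u) x :=
      (hu.fderiv_right (m := ∞) (by simp)).differentiable (by simp) x
    have := (hd.hasFDerivAt.clm_apply (hasFDerivAt_const (Pi.single i (1 : ℝ)) x)).fderiv
    change fderiv ℝ (fun y => fderiv ℝ u y (Pi.single i 1)) x _ = _
    rw [this]
    simp
  rw [key, key]
  exact hu.contDiffAt.isSymmSndFDerivAt (by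
    rw [minSmoothness_of_isRCLikeNormedField]
    exact ENat.LEInfty.out) _ _

theorem pd_mul {u v : (Fin n → ℝ) → ℝ} {x : Fin n → ℝ} (hu : DifferentiableAt ℝ u x)
    (hv : DifferentiableAt ℝ v x) (i : Fin n) :
    pd (fun y => u y * v y) i x = pd u i x * v x + u x * pd v i x := by
  simp only [pd]
  rw [fderiv_fun_mul hu hv]
  simp only [add_apply, smul_apply, smul_eq_mul]
  ring

theorem pd_prod {ι : Type*} [Fintype ι] [DecidableEq ι] {u : ι → (Fin n → ℝ) → ℝ}
    {x : Fin n → ℝ} (hu : ∀ l, DifferentiableAt ℝ (u l) x) (i : Fin n) :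
    pd (fun y => ∏ l, u l y) i x = ∑ l, (∏ j ∈ Finset.univ.erase l, u j x) * pd (u l) i x := by
  simp only [pd]
  rw [fderiv_finsetProd fun l _ => hu l]
  simp

theorem integral_pd_mul_eq_neg {u v : (Fin n → ℝ) → ℝ} (hu : ContDiff ℝ ∞ u)
    (hv : ContDiff ℝ ∞ v) (huc : HasCompactSupport u) (i : Fin n) :
    ∫ x, pd u i x * v x = -∫ x, u x * pd v i x := by
  rw [eq_neg_iff_add_eq_zero, add_comm, ← eq_neg_iff_add_eq_zero]
  exact integral_mul_fderiv_eq_neg_fderiv_mul_of_integrable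
    (((hu.pd i).continuous.mul hv.continuous).integrable_of_hasCompactSupport
      (huc.pd i).mul_right)
    ((hu.continuous.mul (hv.pd i).continuous).integrable_of_hasCompactSupport huc.mul_right)
    ((hu.continuous.mul hv.continuous).integrable_of_hasCompactSupport huc.mul_right)
    (fun x _ => hu.differentiable (by simp) x) (fun x _ => hv.differentiable (by simp) x)

theorem sum_sign_mul_pd_prod_pd_eq_zero {f : Fin k → (Fin n → ℝ) → ℝ}
    (hf : ∀ j, ContDiff ℝ ∞ (f j)) (idx : Fin (k + 1) → Fin n) (x : Fin n → ℝ) :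
    ∑ σ : Equiv.Perm (Fin (k + 1)), ((Equiv.Perm.sign σ : ℤ) : ℝ) *
      pd (fun y => ∏ j, pd (f j) (idx (σ j.succ)) y) (idx (σ 0)) x = 0 := by
  simp_rw [fun σ : Equiv.Perm (Fin (k + 1)) => pd_prod (x := x)
    (fun j => ((hf j).pd (idx (σ j.succ))).differentiable (by simp) x) (idx (σ 0)), Finset.mul_sum]
  rw [Finset.sum_comm]
  refine Finset.sum_eq_zero fun l _ => ?_
  refine self_eq_neg.1 ?_
  rw [← Finset.sum_neg_distrib]
  refine Fintype.sum_equiv (Equiv.mulRight (Equiv.swap 0 l.succ)) _ _ fun σ => ?_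
  have hprod : ∏ j ∈ Finset.univ.erase l, pd (f j) (idx ((σ * Equiv.swap 0 l.succ) j.succ)) x =
      ∏ j ∈ Finset.univ.erase l, pd (f j) (idx (σ j.succ)) x := by
    refine Finset.prod_congr rfl fun j hj => ?_
    rw [Equiv.Perm.mul_apply, Equiv.swap_apply_of_ne_of_ne (Fin.succ_ne_zero j)
      (by simpa using Finset.ne_of_mem_erase hj)]
  rw [Equiv.coe_mulRight, hprod, Equiv.Perm.sign_mul, Equiv.Perm.sign_swap (Fin.succ_ne_zero l).symm,
    Equiv.Perm.mul_apply, Equiv.Perm.mul_apply, Equiv.swap_apply_left, Equiv.swap_apply_right,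
    pd_comm (hf l)]
  simp

theorem integral_det_pd_eq_zero {f : Fin (k + 1) → (Fin n → ℝ) → ℝ}
    (hf : ∀ j, ContDiff ℝ ∞ (f j)) (hc : HasCompactSupport (f 0)) (idx : Fin (k + 1) → Fin n) :
    ∫ x, (Matrix.of fun a b => pd (f b) (idx a) x).det = 0 := by
  have hP : ∀ σ : Equiv.Perm (Fin (k + 1)),
      ContDiff ℝ ∞ fun y => ∏ j : Fin k, pd (f j.succ) (idx (σ j.succ)) y := fun σ =>
    contDiff_prod fun j _ => (hf j.succ).pd _
  simp_rw [Matrix.det_apply', Matrix.of_apply, Fin.prod_univ_succ]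
  rw [integral_finsetSum]
  · simp_rw [integral_const_mul, fun σ : Equiv.Perm (Fin (k + 1)) =>
      integral_pd_mul_eq_neg (hf 0) (hP σ) hc (idx (σ 0)), ← integral_neg, ← integral_const_mul]
    rw [← integral_finsetSum]
    · refine integral_eq_zero_of_ae (.of_forall fun x => ?_)
      have h := sum_sign_mul_pd_prod_pd_eq_zero (fun j : Fin k => hf j.succ) idx x
      simp only [mul_neg, mul_left_comm _ (f 0 x), Finset.sum_neg_distrib, ← Finset.mul_sum, h,
        mul_zero, neg_zero, Pi.zero_apply]
    · exact fun σ _ => (((hf 0).continuous.mul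
        ((hP σ).pd _).continuous).integrable_of_hasCompactSupport hc.mul_right).neg.const_mul _
  · exact fun σ _ => ((((hf 0).pd _).continuous.mul
      (hP σ).continuous).integrable_of_hasCompactSupport (hc.pd _).mul_right).const_mul _

theorem continuous_det_pd {ι : Type*} [Fintype ι] [DecidableEq ι] {f : ι → (Fin n → ℝ) → ℝ}
    (hf : ∀ j, ContDiff ℝ ∞ (f j)) (idx : ι → Fin n) :
    Continuous fun x => (Matrix.of fun a b => pd (f b) (idx a) x).det :=
  Continuous.matrix_det (continuous_pi fun _ => continuous_pi fun b => ((hf b).pd _).continuous)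

theorem integral_det_pd_mul_eq_of_contDiff {f : Fin (k + 1) → (Fin n → ℝ) → ℝ}
    (hf : ∀ j, ContDiff ℝ ∞ (f j)) (idx : Fin (k + 1) → Fin n) {φ : (Fin n → ℝ) → ℝ}
    (hφ : ContDiff ℝ ∞ φ) (hφc : HasCompactSupport φ) :
    ∫ x, (Matrix.of fun a b => pd (f b) (idx a) x).det * φ x =
      -∑ a : Fin (k + 1), (-1 : ℝ) ^ (a : ℕ) * ∫ x, f 0 x *
        (Matrix.of fun b j : Fin k => pd (f j.succ) (idx (a.succAbove b)) x).det *
          pd φ (idx a) x := by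
  rw [eq_neg_iff_add_eq_zero]
  simp_rw [← integral_const_mul]
  have hint : ∀ a : Fin (k + 1), Integrable fun x => (-1 : ℝ) ^ (a : ℕ) * (f 0 x *
      (Matrix.of fun b j : Fin k => pd (f j.succ) (idx (a.succAbove b)) x).det *
        pd φ (idx a) x) := fun a =>
    ((((hf 0).continuous.mul (continuous_det_pd (fun j : Fin k => hf j.succ) _)).mul
      (hφ.pd _).continuous).integrable_of_hasCompactSupport (hφc.pd _).mul_left).const_mul _
  have hint' : Integrable fun x => (Matrix.of fun a b => pd (f b) (idx a) x).det * φ x :=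
    ((continuous_det_pd hf idx).mul hφ.continuous).integrable_of_hasCompactSupport hφc.mul_left
  rw [← integral_finsetSum _ fun a _ => hint a, ← integral_add hint'
    (integrable_finsetSum _ fun a _ => hint a)]
  have hF : ∀ j, ContDiff ℝ ∞
      ((Fin.cons (fun x => f 0 x * φ x) fun j => f j.succ : Fin (k + 1) → (Fin n → ℝ) → ℝ) j) :=
    Fin.cases ((hf 0).mul hφ) fun j => hf j.succ
  rw [← integral_det_pd_eq_zero hF hφc.mul_left idx]
  congr 1 with x
  rw [Matrix.det_succ_column_zero, Matrix.det_succ_column_zero, Finset.sum_mul,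
    ← Finset.sum_add_distrib]
  refine Finset.sum_congr rfl fun a _ => ?_
  simp only [Matrix.of_apply, Matrix.submatrix, Fin.cons_zero, Fin.cons_succ]
  rw [pd_mul ((hf 0).differentiable (by simp) x) (hφ.differentiable (by simp) x)]
  ring

end Smooth

section Lipschitz

variable {n k : ℕ}

theorem abs_pd_le {u : (Fin n → ℝ) → ℝ} {K : NNReal} (hu : LipschitzWith K u) (i : Fin n)
    (x : Fin n → ℝ) : |pd u i x| ≤ K := by
  have h := (fderiv ℝ u x).le_of_opNorm_le (norm_fderiv_le_of_lipschitz ℝ hu) (Pi.single i 1)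
  simpa [pd, Pi.norm_single] using h

theorem abs_det_pd_le {ι : Type*} [Fintype ι] [DecidableEq ι] {f : ι → (Fin n → ℝ) → ℝ}
    {K : NNReal} (hf : ∀ j, LipschitzWith K (f j)) (idx : ι → Fin n) (x : Fin n → ℝ) :
    |(Matrix.of fun a b => pd (f b) (idx a) x).det| ≤
      (Fintype.card ι).factorial • (K : ℝ) ^ Fintype.card ι :=
  Matrix.det_le (abv := AbsoluteValue.abs) fun a b => abs_pd_le (hf b) (idx a) x

theorem tendsto_det_pd {ι : Type*} [Fintype ι] [DecidableEq ι] {f : ι → (Fin n → ℝ) → ℝ}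
    {F : ℕ → ι → (Fin n → ℝ) → ℝ} {x : Fin n → ℝ}
    (h : ∀ i, Tendsto (fun m => fderiv ℝ (F m i) x) atTop (𝓝 (fderiv ℝ (f i) x)))
    (idx : ι → Fin n) :
    Tendsto (fun m => (Matrix.of fun a b => pd (F m b) (idx a) x).det) atTop
      (𝓝 (Matrix.of fun a b => pd (f b) (idx a) x).det) := by
  have hdet : Continuous (Matrix.det : Matrix ι ι ℝ → ℝ) := continuous_id.matrix_det
  refine (hdet.tendsto _).comp (tendsto_pi_nhds.2 fun a => tendsto_pi_nhds.2 fun b => ?_)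
  exact ((ContinuousLinearMap.apply ℝ ℝ (Pi.single (idx a) 1 : Fin n → ℝ)).continuous.tendsto
    _).comp (h b)

theorem integral_det_pd_mul_eq_of_lipschitzWith {f : Fin (k + 1) → (Fin n → ℝ) → ℝ} {K : NNReal}
    (hf : ∀ j, LipschitzWith K (f j)) (idx : Fin (k + 1) → Fin n) {φ : (Fin n → ℝ) → ℝ}
    (hφ : ContDiff ℝ ∞ φ) (hφc : HasCompactSupport φ) :
    ∫ x, (Matrix.of fun a b => pd (f b) (idx a) x).det * φ x =
      -∑ a : Fin (k + 1), (-1 : ℝ) ^ (a : ℕ) * ∫ x, f 0 x *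
        (Matrix.of fun b j : Fin k => pd (f j.succ) (idx (a.succAbove b)) x).det *
          pd φ (idx a) x := by
  obtain ⟨F, hF, hFL, hFf, hFd⟩ := LipschitzWith.exists_contDiff_tendsto (μ := volume) hf
  obtain ⟨C, hC⟩ := (hFf 0 0).abs.bddAbove_range
  have hC' : ∀ m x, |F m 0 x| ≤ C + K * ‖x‖ := fun m x => by
    have h1 : |F m 0 0| ≤ C := hC ⟨m, rfl⟩
    have h2 := (hFL m 0).norm_sub_le x 0
    have h3 := abs_sub_abs_le_abs_sub (F m 0 x) (F m 0 0)
    rw [sub_zero, Real.norm_eq_abs] at h2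
    linarith
  refine tendsto_nhds_unique (f := fun m => ∫ x,
    (Matrix.of fun a b => pd (F m b) (idx a) x).det * φ x) (l := atTop) ?_ ?_
  · refine tendsto_integral_of_dominated_convergence
      (fun x => (Fintype.card (Fin (k + 1))).factorial • (K : ℝ) ^ Fintype.card (Fin (k + 1)) *
        |φ x|) (fun m => ((continuous_det_pd (hF m) idx).mul hφ.continuous).aestronglyMeasurable)
      ((hφ.continuous.integrable_of_hasCompactSupport hφc).abs.const_mul _)
      (fun m => .of_forall fun x => ?_) ?_
    · rw [Real.norm_eq_abs, abs_mul]
      exact mul_le_mul_of_nonneg_right (abs_det_pd_le (hFL m) idx x) (abs_nonneg _)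
    · filter_upwards [hFd] with x hx
      exact (tendsto_det_pd hx idx).mul_const _
  · simp_rw [fun m => integral_det_pd_mul_eq_of_contDiff (hF m) idx hφ hφc]
    refine (tendsto_finsetSum _ fun a _ => Tendsto.const_mul _ ?_).neg
    refine tendsto_integral_of_dominated_convergence
      (fun x => (C + K * ‖x‖) * ((Fintype.card (Fin k)).factorial • (K : ℝ) ^ Fintype.card (Fin k)) *
        |pd φ (idx a) x|) (fun m => (((hF m 0).continuous.mul (continuous_det_pd
        (fun j : Fin k => hF m j.succ) _)).mul (hφ.pd _).continuous).aestronglyMeasurable)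
      ?_ (fun m => .of_forall fun x => ?_) ?_
    · refine Continuous.integrable_of_hasCompactSupport ?_ (hφc.pd (idx a)).abs.mul_left
      have := (hφ.pd (idx a)).continuous
      fun_prop
    · rw [Real.norm_eq_abs, abs_mul, abs_mul]
      have h0 := hC' m x
      gcongr
      · exact (abs_nonneg _).trans h0
      · exact abs_det_pd_le (fun j : Fin k => hFL m j.succ) _ x
    · filter_upwards [hFd] with x hx
      exact ((hFf 0 x).mul (tendsto_det_pd (fun j : Fin k => hx j.succ) _)).mul_const _

end Lipschitz

end

/-- Coordinate formulation on `ℝⁿ` of Lemma 2.3 of the paper: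
`d(g · dh₁ ∧ … ∧ dh_k) = dg ∧ dh₁ ∧ … ∧ dh_k` in the weak sense, evaluated on the
coordinate directions `e_{i₀}, …, e_{i_k}` against a test function `φ`. -/
theorem weak_exterior_differential_lipschitz
    (n k : ℕ) (hn : 2 ≤ n) (hk1 : 1 ≤ k) (hkn : k ≤ n - 1)
    (g : (Fin n → ℝ) → ℝ) (h : Fin k → (Fin n → ℝ) → ℝ)
    (Kg : NNReal) (hg : LipschitzWith Kg g)
    (Kh : Fin k → NNReal) (hh : ∀ j, LipschitzWith (Kh j) (h j))
    (idx : Fin (k + 1) → Fin n) (hidx : StrictMono idx)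
    (φ : (Fin n → ℝ) → ℝ) (hφ : ContDiff ℝ (⊤ : ℕ∞) φ) (hφc : HasCompactSupport φ) :
    ∫ x : Fin n → ℝ,
        (Matrix.of fun a b : Fin (k + 1) =>
            Fin.cases (pd g (idx a) x) (fun j => pd (h j) (idx a) x) b).det * φ x
      = - ∑ a : Fin (k + 1), (-1 : ℝ) ^ (a : ℕ) *
          ∫ x : Fin n → ℝ,
            g x * (Matrix.of fun (b j : Fin k) =>
                pd (h j) (idx (a.succAbove b)) x).det * pd φ (idx a) x := by
  have hf : ∀ j, LipschitzWith (Kg ⊔ Finset.univ.sup Kh)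
      ((Fin.cons g h : Fin (k + 1) → (Fin n → ℝ) → ℝ) j) :=
    Fin.cases (hg.weaken le_sup_left)
      fun j => (hh j).weaken ((Finset.le_sup (Finset.mem_univ j)).trans le_sup_right)
  have key := integral_det_pd_mul_eq_of_lipschitzWith hf idx hφ hφc
  simp only [Fin.cons_zero, Fin.cons_succ] at key
  rw [← key]
  congr! 7 with x a b
  cases b using Fin.cases <;> rfl
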